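/- Let φ be a 2-CNF formula in n Boolean variables and let S = sat(φ) be nonempty, and suppose p = prj(S) satisfies 1 ≤ p ≤ n. Then |S| ≤ (n/p + 1)^p (where the right-hand side is a real power). -/

import Mathlib

/-- A literal is a pair (variable, required value); an assignment `x` satisfies a
clause (a finite set of literals, interpreted as their disjunction) if some literal
of the clause gets its required value. -/
def ClauseSat {n : ℕ} (C : Finset (Fin n × ZMod 2)) (x : Fin n → ZMod 2) : Prop :=
  ∃ l ∈ C, x l.1 = l.2

/-- The set of satisfying assignments of a CNF formula (a finite list of clauses,
interpreted as their conjunction). -/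
def SatAssignments {n : ℕ} (φ : List (Finset (Fin n × ZMod 2))) :
    Set (Fin n → ZMod 2) :=
  {x | ∀ C ∈ φ, ClauseSat C x}

/-- A `k`-CNF formula: every clause has at most `k` literals. -/
def IsKCnf {n : ℕ} (k : ℕ) (φ : List (Finset (Fin n × ZMod 2))) : Prop :=
  ∀ C ∈ φ, C.card ≤ k

/-- `P` is a projection of dimension `δ` in `{0,1}^n`. -/
def IsProjection {n : ℕ} (δ : ℕ) (P : Set (Fin n → ZMod 2)) : Prop :=
  ∃ A B : Fin (δ + 1) → Finset (Fin n),
    (∀ i, Disjoint (A i) (B i)) ∧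
    (∀ i j, i ≠ j → Disjoint (A i ∪ B i) (A j ∪ B j)) ∧
    (Finset.univ.biUnion fun i => A i ∪ B i) = Finset.univ ∧
    (∀ i, i ≠ 0 → (A i ∪ B i).Nonempty) ∧
    P = {x | (∀ j ∈ A 0, x j = 0) ∧ (∀ j ∈ B 0, x j = 1) ∧
      ∀ i, i ≠ 0 → ∃ b : ZMod 2,
        (∀ j ∈ A i, x j = b) ∧ (∀ j ∈ B i, x j = 1 - b)}

/-- `prj(S)` : the dimension of the largest projection contained in `S`. -/
noncomputable def prjDim {n : ℕ} (S : Set (Fin n → ZMod 2)) : ℕ :=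
  sSup {δ | ∃ P : Set (Fin n → ZMod 2), IsProjection δ P ∧ P ⊆ S}

open Finset in
theorem aux_amgm (q : ℕ) (D N : ℝ) (hD : 0 ≤ D) (hDN : D ≤ N) :
    (D / q + 1) ^ q * (1 + (N - D)) ≤ (N / ((q + 1 : ℕ) : ℝ) + 1) ^ (q + 1) := by
  rcases Nat.eq_zero_or_pos q with rfl | hq
  · simp; linarith
  have hq' : (0 : ℝ) < q := by exact_mod_cast hq
  set x : ℝ := D / q + 1 with hx
  have hx1 : 0 < x := by positivity
  have hDx : D = q * (x - 1) := by rw [hx]; field_simp; ring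
  set M : ℝ := N / ((q + 1 : ℕ) : ℝ) + 1 with hM
  have hM0 : 0 < M := by
    have : 0 ≤ N := hD.trans hDN
    positivity
  have hNM : N = (q + 1) * (M - 1) := by
    rw [hM]; push_cast; field_simp; ring
  have hb := one_add_mul_le_pow (a := M / x - 1) (by
    have : 0 < M / x := by positivity
    linarith) (q + 1)
  have h2 : (1 + (M / x - 1)) = M / x := by ring
  rw [h2, div_pow, le_div_iff₀ (by positivity)] at hb
  have h3 : (1 + ((q + 1 : ℕ) : ℝ) * (M / x - 1)) * x ^ (q + 1)
      = x ^ q * (1 + (N - D)) := by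
    rw [hNM, hDx]; push_cast; field_simp; ring
  linarith [h3.symm.le]

open Finset Classical in
theorem aux_zykov {α : Type*} (R : α → α → Prop) (hsymm : ∀ a b, R a b → R b a) (p : ℕ) :
    ∀ s : Finset α,
      (∀ t ⊆ s, (t : Set α).Pairwise R → t.card ≤ p) →
      (((s.powerset.filter fun t : Finset _ => (t : Set α).Pairwise R).card : ℕ) : ℝ)
        ≤ ((s.card : ℝ) / p + 1) ^ p := by
  induction p with
  | zero =>
    intro s hs
    have : (s.powerset.filter fun t : Finset _ => (t : Set α).Pairwise R) ⊆ {∅} := by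
      intro t ht
      simp only [mem_filter, mem_powerset] at ht
      have := hs t ht.1 ht.2
      simpa using this
    have := card_le_card this
    simp at this ⊢
    exact this
  | succ q ih =>
    intro s hs
    rcases s.eq_empty_or_nonempty with rfl | hne
    · simp [filter_singleton]
    let Nb : α → Finset α := fun u => s.filter fun w => w ≠ u ∧ R u w
    let K : Finset α → Finset (Finset α) := fun s =>
      s.powerset.filter fun t : Finset _ => (t : Set α).Pairwise R
    obtain ⟨v, hv, hmax⟩ := exists_max_image s (fun u => (Nb u).card) hne
    have hins : ∀ u ∈ s, ∀ t ⊆ Nb u, (t : Set α).Pairwise R →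
        u ∉ t ∧ insert u t ⊆ s ∧ ((insert u t : Finset α) : Set α).Pairwise R := by
      intro u hu t ht hc
      refine ⟨fun h => ?_, ?_, ?_⟩
      · have := ht h
        simp [Nb] at this
      · intro w hw
        rcases mem_insert.1 hw with rfl | hw
        · exact hu
        · exact (mem_filter.1 (ht hw)).1
      · rw [coe_insert]
        refine hc.insert fun b hb _ => ?_
        have h1 := (mem_filter.1 (ht hb)).2.2
        exact ⟨h1, hsymm _ _ h1⟩
    have hK : ∀ u ∈ s, ((K (Nb u)).card : ℝ) ≤ (((Nb v).card : ℝ) / q + 1) ^ q := by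
      intro u hu
      refine (ih (Nb u) ?_).trans ?_
      · intro t ht hc
        obtain ⟨h1, h2, h3⟩ := hins u hu t ht hc
        have := hs _ h2 h3
        rw [card_insert_of_notMem h1] at this
        omega
      · have := hmax u hu
        gcongr
    have hcov : K s ⊆ K (Nb v) ∪ (s \ Nb v).biUnion fun u => (K (Nb u)).image (insert u) := by
      intro t ht
      simp only [K, mem_filter, mem_powerset] at ht
      by_cases h : t ⊆ Nb v
      · refine mem_union_left _ ?_
        simp only [K, mem_filter, mem_powerset]
        exact ⟨h, ht.2⟩
      · obtain ⟨u, hut, huN⟩ := not_subset.1 h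
        refine mem_union_right _ (mem_biUnion.2 ⟨u, mem_sdiff.2 ⟨ht.1 hut, huN⟩, ?_⟩)
        refine mem_image.2 ⟨t.erase u, ?_, insert_erase hut⟩
        simp only [K, mem_filter, mem_powerset]
        refine ⟨?_, ht.2.mono (by simp)⟩
        intro w hw
        have hw' := mem_erase.1 hw
        exact mem_filter.2 ⟨ht.1 hw'.2, hw'.1, ht.2 hut hw'.2 (Ne.symm hw'.1)⟩
    have hNs : Nb v ⊆ s := filter_subset _ _
    have hcard : ((K s).card : ℝ) ≤
        (((Nb v).card : ℝ) / q + 1) ^ q * (1 + ((s.card : ℝ) - (Nb v).card)) := by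
      have h1 : (K s).card ≤ (K (Nb v)).card + ∑ u ∈ s \ Nb v, (K (Nb u)).card := by
        refine (card_le_card hcov).trans ((card_union_le _ _).trans ?_)
        refine Nat.add_le_add_left (card_biUnion_le.trans ?_) _
        exact sum_le_sum fun u _ => card_image_le
      have h2 : ((K s).card : ℝ) ≤ (K (Nb v)).card + ∑ u ∈ s \ Nb v, ((K (Nb u)).card : ℝ) := by
        exact_mod_cast h1
      have h3 : ∑ u ∈ s \ Nb v, ((K (Nb u)).card : ℝ) ≤
          ((s \ Nb v).card : ℝ) * (((Nb v).card : ℝ) / q + 1) ^ q := by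
        rw [← nsmul_eq_mul]
        exact sum_le_card_nsmul _ _ _ fun u hu => hK u (mem_sdiff.1 hu).1
      have h4 : ((s \ Nb v).card : ℝ) = (s.card : ℝ) - (Nb v).card := by
        rw [card_sdiff_of_subset hNs, Nat.cast_sub (card_le_card hNs)]
      rw [h4] at h3
      have h5 := hK v hv
      nlinarith
    refine hcard.trans (aux_amgm q _ _ (by positivity) ?_)
    exact_mod_cast card_le_card hNs

theorem aux_zmod (a b c : ZMod 2) (h : a ≠ b) (h' : a ≠ c) : b = c := by
  revert a b c; decide

open Finset Classical in
theorem aux_proj {n d : ℕ} (φ : List (Finset (Fin n × ZMod 2))) (h2 : IsKCnf 2 φ)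
    (s : Fin n → ZMod 2) (hs : s ∈ SatAssignments φ) (y : Fin d → Fin n)
    (hpair : ∀ i j, i ≠ j → ∀ a b, ∃ x ∈ SatAssignments φ, x (y i) = a ∧ x (y j) = b)
    (hone : ∀ i a, ∃ x ∈ SatAssignments φ, x (y i) = a) :
    ∃ P : Set (Fin n → ZMod 2), IsProjection d P ∧ P ⊆ SatAssignments φ := by
  set S := SatAssignments φ with hS
  let Imp : Fin d → ZMod 2 → Fin n → ZMod 2 → Prop := fun i c z v =>
    ∀ x ∈ S, x (y i) = c → x z = v
  let A' : Fin d → Finset (Fin n) := fun i => univ.filter fun z => ∀ x ∈ S, x z = x (y i)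
  let B' : Fin d → Finset (Fin n) := fun i => univ.filter fun z => ∀ x ∈ S, x z = 1 - x (y i)
  have mA : ∀ i z, z ∈ A' i ↔ ∀ x ∈ S, x z = x (y i) := by intro i z; simp [A']
  have mB : ∀ i z, z ∈ B' i ↔ ∀ x ∈ S, x z = 1 - x (y i) := by intro i z; simp [B']
  let Blk : Fin n → Prop := fun z => ∃ i, z ∈ A' i ∪ B' i
  have hw : ∀ z, ∃ v, ¬ Blk z → (∀ i c v', Imp i c z v' → v = v') ∧
      ((∀ i c v', ¬ Imp i c z v') → v = s z) := by
    intro z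
    by_cases hz : Blk z
    · exact ⟨0, fun h => absurd hz h⟩
    by_cases hI : ∃ i c v, Imp i c z v
    · obtain ⟨i, c, v, hv⟩ := hI
      refine ⟨v, fun _ => ⟨?_, fun h => absurd hv (h _ _ _)⟩⟩
      intro j c' v' hv'
      by_contra hne
      by_cases hij : i = j
      · subst hij
        by_cases hcc : c = c'
        · subst hcc
          obtain ⟨u, hu, huc⟩ := hone i c
          exact hne ((hv u hu huc).symm.trans (hv' u hu huc))
        · apply hz
          refine ⟨i, mem_union.2 ?_⟩
          rw [mA, mB]
          have key : ∀ c c' v v' a b : ZMod 2, v ≠ v' → c ≠ c' → (a = c → b = v) →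
              (a = c' → b = v') → (v = c → b = a) ∧ (v ≠ c → b = 1 - a) := by decide
          by_cases hvc : v = c
          · exact Or.inl fun x hx => (key c c' v v' _ _ hne hcc (hv x hx) (hv' x hx)).1 hvc
          · exact Or.inr fun x hx => (key c c' v v' _ _ hne hcc (hv x hx) (hv' x hx)).2 hvc
      · obtain ⟨u, hu, h1, h2⟩ := hpair i j hij c c'
        exact hne ((hv u hu h1).symm.trans (hv' u hu h2))
    · refine ⟨s z, fun _ => ⟨fun i c v h => absurd ⟨i, c, v, h⟩ hI, fun _ => rfl⟩⟩
  choose w hw using hw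
  let A : Fin (d + 1) → Finset (Fin n) :=
    Fin.cases (univ.filter fun z => ¬ Blk z ∧ w z = 0) A'
  let B : Fin (d + 1) → Finset (Fin n) :=
    Fin.cases (univ.filter fun z => ¬ Blk z ∧ w z = 1) B'
  have hA0 : A 0 = univ.filter fun z => ¬ Blk z ∧ w z = 0 := rfl
  have hB0 : B 0 = univ.filter fun z => ¬ Blk z ∧ w z = 1 := rfl
  have hAs : ∀ i : Fin d, A i.succ = A' i := fun i => rfl
  have hBs : ∀ i : Fin d, B i.succ = B' i := fun i => rfl
  have h01 : ∀ a : ZMod 2, a = 0 ∨ a = 1 := by decide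
  have hzs : ∀ i : Fin d, Disjoint (A 0 ∪ B 0) (A i.succ ∪ B i.succ) := by
    intro i
    rw [Finset.disjoint_left]
    intro z hz hz'
    rw [hAs, hBs] at hz'
    have : Blk z := ⟨i, hz'⟩
    simp [hA0, hB0, this] at hz
  refine ⟨_, ⟨A, B, ?_, ?_, ?_, ?_, rfl⟩, ?_⟩
  · intro i
    rw [Finset.disjoint_left]
    refine Fin.cases ?_ (fun i => ?_) i
    · intro z hz hz'
      simp only [hA0, hB0, mem_filter] at hz hz'
      have := hz.2.2.symm.trans hz'.2.2
      exact absurd this (by decide)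
    · intro z hz hz'
      rw [hAs, mA] at hz
      rw [hBs, mB] at hz'
      have := (hz s hs).symm.trans (hz' s hs)
      revert this
      generalize s (y i) = a
      revert a; decide
  · intro i j
    refine Fin.cases ?_ (fun i => ?_) i <;> refine Fin.cases ?_ (fun j => ?_) j
    · intro h; exact absurd rfl h
    · intro _; exact hzs j
    · intro _; exact (hzs i).symm
    · intro hij
      have hij' : i ≠ j := fun h => hij (by rw [h])
      rw [Finset.disjoint_left]
      intro z hz hz'
      rw [hAs, hBs, mem_union, mA, mB] at hz hz'
      obtain ⟨u, hu, hu1, hu2⟩ := hpair i j hij' 0 0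
      obtain ⟨u', hu', hu1', hu2'⟩ := hpair i j hij' 0 1
      rcases hz with hz | hz <;> rcases hz' with hz' | hz' <;>
      · have e1 := (hz u hu).symm.trans (hz' u hu)
        have e2 := (hz u' hu').symm.trans (hz' u' hu')
        rw [hu1, hu2] at e1
        rw [hu1', hu2'] at e2
        revert e1 e2
        decide
  · refine eq_univ_iff_forall.2 fun z => ?_
    rw [mem_biUnion]
    by_cases hz : Blk z
    · obtain ⟨i, hi⟩ := hz
      exact ⟨i.succ, mem_univ _, hi⟩
    · refine ⟨0, mem_univ _, ?_⟩
      rw [hA0, hB0]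
      rcases h01 (w z) with h | h
      · exact mem_union_left _ (by simp [hz, h])
      · exact mem_union_right _ (by simp [hz, h])
  · intro i
    refine Fin.cases (fun h => absurd rfl h) (fun i _ => ?_) i
    refine ⟨y i, mem_union_left _ ?_⟩
    rw [hAs, mA]
    intro x _; rfl
  · rintro x ⟨hxA, hxB, hxi⟩
    have hxw : ∀ z, ¬ Blk z → x z = w z := by
      intro z hz
      rcases h01 (w z) with h | h
      · rw [h]; exact hxA z (by rw [hA0]; simp [hz, h])
      · rw [h]; exact hxB z (by rw [hB0]; simp [hz, h])
    have hxblk : ∀ i z, z ∈ A' i ∪ B' i → ∀ u ∈ S, u (y i) = x (y i) → u z = x z := by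
      intro i z hz u hu huy
      obtain ⟨b, hb1, hb2⟩ := hxi i.succ (Fin.succ_ne_zero i)
      rw [hAs] at hb1
      rw [hBs] at hb2
      have hyb : x (y i) = b := hb1 (y i) (by rw [mA]; intro x _; rfl)
      rcases mem_union.1 hz with h | h
      · rw [hb1 z h, (mA i z).1 h u hu, huy, hyb]
      · rw [hb2 z h, (mB i z).1 h u hu, huy, hyb]
    have claim : ∀ i z v, Imp i (x (y i)) z v → x z = v := by
      intro i z v h
      by_cases hz : Blk z
      · obtain ⟨j, hj⟩ := hz
        have : ∃ u ∈ S, u (y i) = x (y i) ∧ u (y j) = x (y j) := by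
          by_cases hij : i = j
          · subst hij
            obtain ⟨u, hu, h⟩ := hone i (x (y i))
            exact ⟨u, hu, h, h⟩
          · exact hpair i j hij _ _
        obtain ⟨u, hu, h1, h2⟩ := this
        rw [← hxblk j z hj u hu h2]
        exact h u hu h1
      · rw [hxw z hz]
        exact (hw z hz).1 _ _ _ h
    intro C hC
    have hlm : ∃ l m, ∀ q, q ∈ C ↔ q = l ∨ q = m := by
      obtain ⟨l, hl, _⟩ := hs C hC
      have h1 := h2 C hC
      have h3 : (C.erase l).card ≤ 1 := by rw [card_erase_of_mem hl]; omega
      rcases (C.erase l).eq_empty_or_nonempty with he | ⟨m, hm⟩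
      · refine ⟨l, l, fun q => ⟨fun hq => ?_, ?_⟩⟩
        · by_contra hne
          have : q ∈ C.erase l := mem_erase.2 ⟨by tauto, hq⟩
          rw [he] at this
          simp at this
        · rintro (rfl | rfl) <;> exact hl
      · refine ⟨l, m, fun q => ⟨fun hq => ?_, ?_⟩⟩
        · by_cases hql : q = l
          · exact Or.inl hql
          · exact Or.inr (card_le_one.1 h3 q (mem_erase.2 ⟨hql, hq⟩) m hm)
        · rintro (rfl | rfl)
          · exact hl
          · exact (mem_erase.1 hm).2
    obtain ⟨l, m, hlm⟩ := hlm
    by_contra hviol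
    have hxl : x l.1 ≠ l.2 := fun h => hviol ⟨l, (hlm l).2 (Or.inl rfl), h⟩
    have hxm : x m.1 ≠ m.2 := fun h => hviol ⟨m, (hlm m).2 (Or.inr rfl), h⟩
    have hcl : ∀ u ∈ S, u l.1 = l.2 ∨ u m.1 = m.2 := by
      intro u hu
      obtain ⟨q, hq, h⟩ := hu C hC
      rcases (hlm q).1 hq with rfl | rfl
      · exact Or.inl h
      · exact Or.inr h
    -- no literal variable is in a block
    have noblk : ∀ l m : Fin n × ZMod 2, x l.1 ≠ l.2 → x m.1 ≠ m.2 →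
        (∀ u ∈ S, u l.1 = l.2 ∨ u m.1 = m.2) → ¬ Blk l.1 := by
      rintro l m hxl hxm hcl ⟨i, hi⟩
      refine hxm (claim i _ _ fun u hu huy => ?_)
      refine (hcl u hu).resolve_left ?_
      rw [hxblk i _ hi u hu huy]
      exact hxl
    have bl := noblk l m hxl hxm hcl
    have bm := noblk m l hxm hxl fun u hu => (hcl u hu).symm
    have noimp : ∀ l m : Fin n × ZMod 2, x l.1 ≠ l.2 → x m.1 ≠ m.2 → ¬ Blk l.1 → ¬ Blk m.1 →
        (∀ u ∈ S, u l.1 = l.2 ∨ u m.1 = m.2) → x l.1 = s l.1 := by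
      intro l m hxl hxm bl bm hcl
      rw [hxw _ bl]
      refine (hw _ bl).2 fun i c v hI => ?_
      have hv : x l.1 = v := (hxw _ bl).trans ((hw _ bl).1 _ _ _ hI)
      have : Imp i c m.1 m.2 := by
        intro u hu huy
        refine (hcl u hu).resolve_left ?_
        rw [hI u hu huy, ← hv]
        exact hxl
      exact hxm ((hxw _ bm).trans ((hw _ bm).1 _ _ _ this))
    have el := noimp l m hxl hxm bl bm hcl
    have em := noimp m l hxm hxl bm bl fun u hu => (hcl u hu).symm
    rcases hcl s hs with h | h
    · exact hxl (el.trans h)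
    · exact hxm (em.trans h)

open Finset Classical in
theorem aux_shatter {n : ℕ} (S : Set (Fin n → ZMod 2)) (s : Finset (Fin n))
    (hs : (univ.filter fun T : Finset (Fin n) =>
      (fun i => if i ∈ T then (1 : ZMod 2) else 0) ∈ S).Shatters s)
    (c : Fin n → ZMod 2) : ∃ x ∈ S, ∀ i ∈ s, x i = c i := by
  obtain ⟨u, hu, hsu⟩ := hs (t := s.filter fun i => c i = 1) (filter_subset _ _)
  refine ⟨_, (mem_filter.1 hu).2, fun i hi => ?_⟩
  have h01 : ∀ a : ZMod 2, a ≠ 1 → a = 0 := by decide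
  have : i ∈ u ↔ c i = 1 := by
    have := Finset.ext_iff.1 hsu i
    simpa [hi] using this
  by_cases h : c i = 1
  · simp [this, h]
  · simp [this, h01 _ h]

open Finset Classical in
theorem aux_zykov_family {α : Type*} (R : α → α → Prop) (hsymm : ∀ a b, R a b → R b a) (p : ℕ)
    (s : Finset α) (hs : ∀ t ⊆ s, (t : Set α).Pairwise R → t.card ≤ p)
    (K : Finset (Finset α)) (hK : ∀ t ∈ K, t ⊆ s ∧ (t : Set α).Pairwise R) :
    ((K.card : ℕ) : ℝ) ≤ ((s.card : ℝ) / p + 1) ^ p := by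
  refine le_trans (Nat.cast_le.2 (card_le_card fun t ht => ?_)) (aux_zykov R hsymm p s hs)
  exact mem_filter.2 ⟨mem_powerset.2 (hK t ht).1, (hK t ht).2⟩

theorem stmt_11 {n p : ℕ} (φ : List (Finset (Fin n × ZMod 2)))
    (h2 : IsKCnf 2 φ) (hne : (SatAssignments φ).Nonempty)
    (hp : prjDim (SatAssignments φ) = p) (hp1 : 1 ≤ p) (hpn : p ≤ n) :
    ((SatAssignments φ).ncard : ℝ) ≤ ((n : ℝ) / p + 1) ^ p := by
  classical
  obtain ⟨s₀, hs₀⟩ := hne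
  set S := SatAssignments φ with hS
  let R : Fin n → Fin n → Prop := fun i j => ∀ a b, ∃ x ∈ S, x i = a ∧ x j = b
  let V : Finset (Fin n) := Finset.univ.filter fun i => ∀ a, ∃ x ∈ S, x i = a
  have hR : ∀ a b, R a b → R b a := by
    intro i j h a b
    obtain ⟨x, hx, h1, h2⟩ := h b a
    exact ⟨x, hx, h2, h1⟩
  have hbdd : BddAbove {δ | ∃ P : Set (Fin n → ZMod 2), IsProjection δ P ∧ P ⊆ S} := by
    by_contra h
    have : prjDim S = 0 := Nat.sSup_of_not_bddAbove h
    omega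
  have hclique : ∀ t ⊆ V, (t : Set (Fin n)).Pairwise R → t.card ≤ p := by
    intro t ht hc
    rw [← hp]
    refine le_csSup hbdd ?_
    refine aux_proj φ h2 s₀ hs₀ (fun i => (t.equivFin.symm i : Fin n)) ?_ ?_
    · intro i j hij
      refine hc (t.equivFin.symm i).2 (t.equivFin.symm j).2 ?_
      intro h
      exact hij (t.equivFin.symm.injective (Subtype.ext h))
    · intro i
      exact (Finset.mem_filter.1 (ht (t.equivFin.symm i).2)).2
  let F : Finset (Fin n) → (Fin n → ZMod 2) := fun T i => if i ∈ T then (1 : ZMod 2) else 0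
  let 𝒜 : Finset (Finset (Fin n)) := Finset.univ.filter fun T => F T ∈ S
  have h1 : S.ncard ≤ 𝒜.card := by
    have hsub : S ⊆ ((𝒜.image F : Finset _) : Set (Fin n → ZMod 2)) := by
      intro x hx
      have hF : F (Finset.univ.filter fun i => x i = 1) = x := by
        have h01 : ∀ a : ZMod 2, (if a = 1 then (1 : ZMod 2) else 0) = a := by decide
        funext i
        simp [F, h01]
      rw [Finset.mem_coe, Finset.mem_image]
      refine ⟨_, ?_, hF⟩
      simp only [𝒜, Finset.mem_filter, Finset.mem_univ, true_and]
      rw [hF]; exact hx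
    have := Set.ncard_le_ncard hsub (Finset.finite_toSet _)
    rw [Set.ncard_coe_finset] at this
    exact this.trans Finset.card_image_le
  have h3 : ∀ t ∈ 𝒜.shatterer, t ⊆ V ∧ (t : Set (Fin n)).Pairwise R := by
    intro t ht
    have ht' := Finset.mem_shatterer.1 ht
    have key := aux_shatter S t (by convert ht')
    constructor
    · intro i hi
      refine Finset.mem_filter.2 ⟨Finset.mem_univ _, fun a => ?_⟩
      obtain ⟨x, hx, h⟩ := key fun _ => a
      exact ⟨x, hx, h i hi⟩
    · intro i hi j hj hij a b
      obtain ⟨x, hx, h⟩ := key fun k => if k = i then a else b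
      refine ⟨x, hx, ?_, ?_⟩
      · simpa using h i hi
      · simpa [hij.symm] using h j hj
  have hz := aux_zykov_family R hR p V hclique 𝒜.shatterer h3
  have h4 : S.ncard ≤ 𝒜.shatterer.card := h1.trans (Finset.card_le_card_shatterer 𝒜)
  have h5 : (S.ncard : ℝ) ≤ ((V.card : ℝ) / p + 1) ^ p := (Nat.cast_le.2 h4).trans hz
  refine h5.trans ?_
  have h6 : V.card ≤ n := by simpa using Finset.card_le_univ V
  gcongr
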